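/- arXiv:2007.14142 — 5 statements merged into one kernel-verified Lean document; each statement's English description precedes it below -/
import Mathlib

section
/- Let m ≥ 0 and k ≥ 2 be integers and let x : {1,…,m} → {0,1,2} be a sequence with total sum S = x(1)+…+x(m). Then {1,…,m} can be split into k contiguous (possibly empty) intervals such that the sum of x over each interval is at most S/2 + 1 if k = 2, and at most S/k + 2 if k > 2 (where S/k denotes real division). -/
/-- Let `m ≥ 0` and `k ≥ 2` be integers and let `x : {1,…,m} → {0,1,2}`
be a sequence with total sum `S = x 1 + … + x m`. Then `{1,…,m}` can be split into `k`
contiguous (possibly empty) intervals (given by cut points `f 0 = 0 ≤ f 1 ≤ … ≤ f k = m`,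
the `t`-th interval being `{f t + 1, …, f (t+1)}`) such that the sum of `x` over each
interval is at most `S/2 + 1` if `k = 2`, and at most `S/k + 2` if `k > 2`
(real division). -/
theorem stmt0 (m k : ℕ) (hk : 2 ≤ k) (x : ℕ → ℕ)
    (hx : ∀ i, 1 ≤ i → i ≤ m → x i ≤ 2) :
    ∃ f : ℕ → ℕ, Monotone f ∧ f 0 = 0 ∧ f k = m ∧
      ∀ t < k, (∑ i ∈ Finset.Ioc (f t) (f (t + 1)), (x i : ℝ)) ≤
        (∑ i ∈ Finset.Icc 1 m, (x i : ℝ)) / k + (if k = 2 then 1 else 2) := by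
  classical
  set P : ℕ → ℕ := fun n => ∑ i ∈ Finset.Ioc 0 n, x i with hP
  have hPmono : ∀ a b, a ≤ b → P b = P a + ∑ i ∈ Finset.Ioc a b, x i := by
    intro a b hab
    exact (Finset.sum_Ioc_consecutive x (Nat.zero_le a) hab).symm
  have hP0 : P 0 = 0 := by simp [hP]
  set S := P m with hS
  set f : ℕ → ℕ := fun t =>
    if t = 0 then 0 else Nat.findGreatest (fun n => k * P n ≤ t * S + k) m with hf
  have f0 : f 0 = 0 := by simp [hf]
  have fpos : ∀ t, t ≠ 0 → f t = Nat.findGreatest (fun n => k * P n ≤ t * S + k) m := by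
    intro t ht
    simp [hf, ht]
  have fk : f k = m := by
    rw [fpos k (by omega)]
    exact Nat.findGreatest_eq (by show k * P m ≤ k * S + k; rw [← hS]; omega)
  have fmono : Monotone f := by
    intro a b hab
    by_cases ha : a = 0
    · subst ha
      rw [f0]; exact Nat.zero_le _
    · rw [fpos a ha, fpos b (by omega)]
      refine Nat.findGreatest_mono_left ?_ m
      intro n hn
      have h1 : a * S ≤ b * S := Nat.mul_le_mul_right S hab
      show k * P n ≤ b * S + k
      have h2 : k * P n ≤ a * S + k := hn
      omega
  have up : ∀ t, k * P (f t) ≤ t * S + k := by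
    intro t
    by_cases ht : t = 0
    · subst ht
      rw [f0, hP0]; simp
    · rw [fpos t ht]
      exact Nat.findGreatest_spec (P := fun n => k * P n ≤ t * S + k) (Nat.zero_le m)
        (by show k * P 0 ≤ t * S + k; rw [hP0]; simp)
  have low : ∀ t, t ≤ k → t * S ≤ k * P (f t) + k := by
    intro t htk
    by_cases ht : t = 0
    · subst ht; simp
    · have hle : f t ≤ m := by rw [← fk]; exact fmono htk
      rcases hle.eq_or_lt with h | h
      · rw [h, ← hS]
        have : t * S ≤ k * S := Nat.mul_le_mul_right S htk
        omega
      · have h1 : ¬ (k * P (f t + 1) ≤ t * S + k) := by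
          have hlt : Nat.findGreatest (fun n => k * P n ≤ t * S + k) m < f t + 1 := by
            rw [← fpos t ht]; omega
          exact Nat.findGreatest_is_greatest (P := fun n => k * P n ≤ t * S + k) hlt (by omega)
        have h2 := hPmono (f t) (f t + 1) (by omega)
        rw [Nat.Ioc_succ_singleton, Finset.sum_singleton] at h2
        have h3 := hx (f t + 1) (by omega) (by omega)
        have h4 : k * P (f t + 1) ≤ k * (P (f t) + 2) := Nat.mul_le_mul_left k (by omega)
        rw [Nat.mul_add] at h4
        omega
  refine ⟨f, fmono, f0, fk, ?_⟩
  intro t ht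
  have e1 : (∑ i ∈ Finset.Icc 1 m, (x i : ℝ)) = (S : ℝ) := by
    rw [hS, hP]; push_cast; rfl
  have e2 := hPmono (f t) (f (t + 1)) (fmono (Nat.le_succ t))
  set Q := ∑ i ∈ Finset.Ioc (f t) (f (t + 1)), x i with hQ
  have e3 : (∑ i ∈ Finset.Ioc (f t) (f (t + 1)), (x i : ℝ)) = (Q : ℝ) := by
    rw [hQ]; push_cast; rfl
  rw [e1, e3]
  have hk0 : (0 : ℝ) < k := by exact_mod_cast (by omega : 0 < k)
  have u := up (t + 1)
  have l := low t ht.le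
  rw [e2] at u
  split_ifs with h2
  · have key : k * Q ≤ S + k := by
      subst h2
      interval_cases t
      · rw [f0, hP0] at u
        omega
      · have : P (f (1 + 1)) = S := by rw [show 1 + 1 = 2 from rfl, fk]
        omega
    have key' : (k : ℝ) * Q ≤ S + k := by exact_mod_cast key
    rw [div_add' _ _ _ hk0.ne', le_div_iff₀ hk0]
    linarith
  · have key : k * Q ≤ S + 2 * k := by
      rw [Nat.mul_add, Nat.add_mul] at u
      omega
    have key' : (k : ℝ) * Q ≤ S + 2 * k := by exact_mod_cast key
    rw [div_add' _ _ _ hk0.ne', le_div_iff₀ hk0]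
    linarith
end

section
/- Let A be an n×n binary array (entries in {0,1}), let 1 ≤ i₁ < i₂ ≤ n be column indices, let k ≥ 2 be an integer and c > 0 a real number. Suppose (w(A[i₁..i₁]) + w(A[i₂..i₂]))/k + w(A[i₁+1..i₂−1]) ≤ c, where w(A[i..j]) is the sum of all entries of A in columns i through j (and w(A[i+1..i−1]) = 0 if the range is empty). Then the subarray A[i₁..i₂] can be partitioned horizontally into k tiles (the rows {1,…,n} split into k contiguous, possibly empty, intervals, each tile consisting of those rows and all columns i₁..i₂) such that: (i) if k = 2, each tile has weight at most c + 1; (ii) if k > 2, each tile has weight at most c + 2. -/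
/-- `A` is a binary array: every entry is `0` or `1`. -/
def Binary (A : ℕ → ℕ → ℕ) : Prop := ∀ r c, A r c ≤ 1

/-- `colW n A i j` is the total weight of columns `i` through `j` of the `n×n` array `A`
(rows and columns indexed `1,…,n`); it is `0` when the column range is empty. -/
def colW (n : ℕ) (A : ℕ → ℕ → ℕ) (i j : ℕ) : ℕ :=
  ∑ r ∈ Finset.Icc 1 n, ∑ col ∈ Finset.Icc i j, A r col

/-- The subarray of `A` consisting of columns `i..j` can be partitioned horizontally into
`m` tiles of weight at most `c`: the rows `{1,…,n}` are split into `m` contiguous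
(possibly empty) intervals by cut points `f 0 = 0 ≤ f 1 ≤ … ≤ f m = n` (the `t`-th
interval being rows `{f t + 1, …, f (t+1)}`), and the total weight of each resulting
tile is at most `c`. -/
def HorizPartition (n : ℕ) (A : ℕ → ℕ → ℕ) (i j m : ℕ) (c : ℝ) : Prop :=
  ∃ f : ℕ → ℕ, Monotone f ∧ f 0 = 0 ∧ f m = n ∧
    ∀ t < m,
      (∑ r ∈ Finset.Ioc (f t) (f (t + 1)), ∑ col ∈ Finset.Icc i j, (A r col : ℝ)) ≤ c

/-- Cutting a sequence with entries at most two into `k` nearly balanced intervals. -/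
lemma cut_exists (n : ℕ) (a : ℕ → ℕ) (ha : ∀ r, a r ≤ 2) (k : ℕ) (hk : 2 ≤ k) :
    ∃ f : ℕ → ℕ, Monotone f ∧ f 0 = 0 ∧ f k = n ∧ (∀ t, f t ≤ n) ∧
      ∀ t < k, k * (∑ r ∈ Finset.Ioc (f t) (f (t + 1)), a r) ≤
        (∑ r ∈ Finset.Ioc 0 n, a r) + k * (if k = 2 then 1 else 2) := by
  obtain ⟨S, hS⟩ : ∃ S : ℕ → ℕ, S = fun r => ∑ x ∈ Finset.Ioc 0 r, a x := ⟨_, rfl⟩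
  obtain ⟨d, hd⟩ : ∃ d : ℕ, d = if k = 2 then 2 else 0 := ⟨_, rfl⟩
  have hS0 : S 0 = 0 := by simp [hS]
  have hSs : ∀ r, S (r + 1) ≤ S r + 2 := by
    intro r
    have := ha (r + 1)
    simp only [hS]
    rw [Finset.sum_Ioc_succ_top (by omega)]
    omega
  have hSd : ∀ x y, x ≤ y → S x + ∑ r ∈ Finset.Ioc x y, a r = S y := by
    intro x y hxy
    simp only [hS]
    exact Finset.sum_Ioc_consecutive _ (by omega) hxy
  let g : ℕ → ℕ := fun t => Nat.findGreatest (fun r => k * S r ≤ t * S n + d) n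
  have hgn : ∀ t, g t ≤ n := fun t => Nat.findGreatest_le n
  have hg1 : ∀ t, k * S (g t) ≤ t * S n + d := by
    intro t
    exact Nat.findGreatest_spec (P := fun r => k * S r ≤ t * S n + d) (m := 0) (Nat.zero_le n)
      (by simp [hS0])
  have hg2 : ∀ t, g t = n ∨ t * S n + d < k * S (g t) + k * 2 := by
    intro t
    by_cases h : g t = n
    · exact Or.inl h
    · right
      have h3 : ¬ (k * S (g t + 1) ≤ t * S n + d) :=
        Nat.findGreatest_is_greatest (P := fun r => k * S r ≤ t * S n + d)
          (Nat.lt_succ_self _) (by have := hgn t; omega)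
      have h4 := Nat.mul_le_mul_left k (hSs (g t))
      rw [Nat.mul_add] at h4
      omega
  have hgm : ∀ s t, s ≤ t → g s ≤ g t := by
    intro s t hst
    apply Nat.findGreatest_mono_left
    intro r hr
    have := Nat.mul_le_mul_right (S n) hst
    show k * S r ≤ t * S n + d
    have hr' : k * S r ≤ s * S n + d := hr
    omega
  have hgk : g k = n := by
    apply le_antisymm (hgn k)
    exact Nat.le_findGreatest le_rfl (by omega)
  have hWn : (∑ r ∈ Finset.Ioc 0 n, a r) = S n := by simp [hS]
  rw [hWn]
  refine ⟨fun t => if t = 0 then 0 else g t, ?_, by simp, ?_, ?_, ?_⟩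
  · intro s t hst
    dsimp only
    split_ifs with h1 h2
    · exact le_rfl
    · exact Nat.zero_le _
    · omega
    · exact hgm s t hst
  · simp only [hgk]
    rw [if_neg (by omega)]
  · intro t
    dsimp only
    split_ifs
    · exact Nat.zero_le _
    · exact hgn t
  · intro t ht
    dsimp only
    rw [if_neg (show t + 1 ≠ 0 by omega)]
    by_cases h0 : t = 0
    · subst h0
      have h5 := hSd 0 (g 1) (Nat.zero_le _)
      have h6 := hg1 1
      rw [if_pos rfl, Nat.zero_add]
      rw [hS0, Nat.zero_add] at h5
      rw [h5]
      split_ifs at hd ⊢ <;> omega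
    · rw [if_neg h0]
      rcases hg2 t with h | h
      · have h7 : g (t + 1) = n := le_antisymm (hgn _) (h ▸ hgm t (t + 1) (by omega))
        rw [h, h7]
        simp
      · have h5 := hSd (g t) (g (t + 1)) (hgm t _ (by omega))
        have h5' := congrArg (k * ·) h5
        simp only [Nat.mul_add] at h5'
        by_cases h2 : k = 2
        · subst h2
          have h8 : t = 1 := by omega
          subst h8
          rw [show (1 + 1 : ℕ) = 2 from rfl, hgk] at *
          simp only [if_true] at hd ⊢
          omega
        · have h6 := hg1 (t + 1)
          rw [Nat.add_mul] at h6
          rw [if_neg h2] at hd ⊢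
          omega

/-- **Lemma '3col'.** Let `A` be an `n×n` binary array, `1 ≤ i₁ < i₂ ≤ n`
column indices, `k ≥ 2` an integer and `c > 0` real. If
`(w(A[i₁..i₁]) + w(A[i₂..i₂]))/k + w(A[i₁+1..i₂−1]) ≤ c`, then the subarray `A[i₁..i₂]`
can be partitioned horizontally into `k` tiles each of weight at most `c + 1` if `k = 2`,
and at most `c + 2` if `k > 2`. -/
theorem stmt1 (n : ℕ) (A : ℕ → ℕ → ℕ) (hA : Binary A)
    (i₁ i₂ : ℕ) (h1 : 1 ≤ i₁) (h12 : i₁ < i₂) (h2 : i₂ ≤ n)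
    (k : ℕ) (hk : 2 ≤ k) (c : ℝ) (hc : 0 < c)
    (hw : ((colW n A i₁ i₁ : ℝ) + (colW n A i₂ i₂ : ℝ)) / k
            + (colW n A (i₁ + 1) (i₂ - 1) : ℝ) ≤ c) :
    HorizPartition n A i₁ i₂ k (c + if k = 2 then 1 else 2) := by
  obtain ⟨f, hm, hf0, hfk, hfn, hf⟩ := cut_exists n (fun r => A r i₁ + A r i₂)
    (fun r => by have := hA r i₁; have := hA r i₂; omega) k hk
  refine ⟨f, hm, hf0, hfk, ?_⟩
  intro t ht
  have hsplit : ∀ r, ∑ col ∈ Finset.Icc i₁ i₂, A r col =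
      (A r i₁ + A r i₂) + ∑ col ∈ Finset.Icc (i₁ + 1) (i₂ - 1), A r col := by
    intro r
    have e1 : Finset.Icc i₁ i₂ = insert i₁ (insert i₂ (Finset.Icc (i₁ + 1) (i₂ - 1))) := by
      ext x
      simp only [Finset.mem_insert, Finset.mem_Icc]
      omega
    rw [e1, Finset.sum_insert, Finset.sum_insert, Nat.add_assoc]
    · simp only [Finset.mem_Icc]
      omega
    · simp only [Finset.mem_insert, Finset.mem_Icc]
      omega
  have hI : Finset.Icc 1 n = Finset.Ioc 0 n := by
    ext x
    simp only [Finset.mem_Icc, Finset.mem_Ioc]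
    omega
  have hM : ∑ r ∈ Finset.Ioc (f t) (f (t + 1)), ∑ col ∈ Finset.Icc (i₁ + 1) (i₂ - 1), A r col
      ≤ colW n A (i₁ + 1) (i₂ - 1) := by
    unfold colW
    apply Finset.sum_le_sum_of_subset
    intro x hx
    have := hfn (t + 1)
    simp only [Finset.mem_Icc, Finset.mem_Ioc] at hx ⊢
    omega
  have hW : ∑ r ∈ Finset.Ioc 0 n, (A r i₁ + A r i₂) = colW n A i₁ i₁ + colW n A i₂ i₂ := by
    unfold colW
    rw [hI, Finset.sum_add_distrib]
    simp
  have hT := hf t ht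
  rw [hW] at hT
  have hcast : (∑ r ∈ Finset.Ioc (f t) (f (t + 1)), ∑ col ∈ Finset.Icc i₁ i₂, (A r col : ℝ)) =
      ((∑ r ∈ Finset.Ioc (f t) (f (t + 1)), (A r i₁ + A r i₂) : ℕ) : ℝ) +
      ((∑ r ∈ Finset.Ioc (f t) (f (t + 1)), ∑ col ∈ Finset.Icc (i₁ + 1) (i₂ - 1), A r col : ℕ)
        : ℝ) := by
    rw [← Nat.cast_add, ← Finset.sum_add_distrib, ← Finset.sum_congr rfl (fun r _ => hsplit r)]
    push_cast
    rfl
  rw [hcast]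
  have hM' : ((∑ r ∈ Finset.Ioc (f t) (f (t + 1)),
      ∑ col ∈ Finset.Icc (i₁ + 1) (i₂ - 1), A r col : ℕ) : ℝ)
      ≤ (colW n A (i₁ + 1) (i₂ - 1) : ℝ) := Nat.cast_le.mpr hM
  have hkpos : (0 : ℝ) < k := by
    have : 0 < k := by omega
    exact_mod_cast this
  generalize (∑ r ∈ Finset.Ioc (f t) (f (t + 1)), (A r i₁ + A r i₂)) = T at hT ⊢
  have hT' : (k : ℝ) * T ≤ ((colW n A i₁ i₁ : ℝ) + (colW n A i₂ i₂ : ℝ))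
      + k * (if k = 2 then 1 else 2) := by exact_mod_cast hT
  have hTd : (T : ℝ) ≤ ((colW n A i₁ i₁ : ℝ) + (colW n A i₂ i₂ : ℝ)) / k
      + (if k = 2 then 1 else 2) := by
    rw [← sub_le_iff_le_add, le_div_iff₀ hkpos]
    linarith
  linarith
end

section
/- Let A be an n×n binary array with a maximal sequence of vertical boundaries b₁ < … < b_k with shadows b'₁, …, b'_k and types t₁, …, t_k with respect to a real threshold c > 0. Then for every index i with 2 ≤ i ≤ k, if b'_i ≠ b_i then t_i > t_{i−1} or b'_{i−1} ≠ b_{i−1}. Equivalently, if b'_{i−1} = b_{i−1} and t_i ≤ t_{i−1}, then b'_i = b_i. -/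
/-- A maximal sequence of `k` vertical boundaries of the `n×n` array `A` with respect to
the threshold `c`, as in Definition 1 of the paper: boundary columns
`1 ≤ b 1 < b 2 < … < b k ≤ n`, shadows `sh i ∈ {b i, b i + 1}`, and types
`t i = ⌊w(A[b i..b i])/c⌋ + 1`, satisfying the iterative defining conditions (1)–(5)
together with the maximality condition (6) at the last boundary. -/
structure VBoundaries (n : ℕ) (A : ℕ → ℕ → ℕ) (c : ℝ) (k : ℕ) where
  /-- the boundary columns `b 1, …, b k` -/
  b : ℕ → ℕ
  /-- the shadow columns `sh 1, …, sh k` -/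
  sh : ℕ → ℕ
  /-- the types `t 1, …, t k` -/
  t : ℕ → ℕ
  one_le_b : 1 ≤ b 1
  b_le_n : b k ≤ n
  strict : ∀ i, 1 ≤ i → i < k → b i < b (i + 1)
  shadow_mem : ∀ i, 1 ≤ i → i ≤ k → sh i = b i ∨ sh i = b i + 1
  type_def : ∀ i, 1 ≤ i → i ≤ k → t i = ⌊(colW n A (b i) (b i) : ℝ) / c⌋₊ + 1
  /-- (1): the first boundary is where the prefix weight first exceeds `c`. -/
  first_le : (colW n A 1 (b 1 - 1) : ℝ) ≤ c
  first_gt : (colW n A 1 (b 1) : ℝ) > c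
  /-- (2): the first shadow. -/
  shadow_one : sh 1 = b 1 ↔ ¬ HorizPartition n A 1 (b 1) (t 1) c
  /-- (3): the next boundary, case `sh i = b i`. -/
  step_eq : ∀ i, 1 ≤ i → i < k → sh i = b i →
    HorizPartition n A (b i) (b (i + 1) - 1) (t i) c ∧
      ¬ HorizPartition n A (b i) (b (i + 1)) (t i) c
  /-- (4): the next boundary, case `sh i ≠ b i`. -/
  step_ne : ∀ i, 1 ≤ i → i < k → sh i ≠ b i →
    (colW n A (b i + 1) (b (i + 1) - 1) : ℝ) ≤ c ∧
      (colW n A (b i + 1) (b (i + 1)) : ℝ) > c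
  /-- (5): the next shadow. -/
  shadow_succ : ∀ i, 1 ≤ i → i < k →
    (sh (i + 1) = b (i + 1) ↔ ¬ HorizPartition n A (sh i) (b (i + 1)) (t (i + 1)) c)
  /-- (6): maximality, case `sh k = b k`. -/
  max_eq : sh k = b k → HorizPartition n A (b k) n (t k) c
  /-- (6): maximality, case `sh k ≠ b k`. -/
  max_ne : sh k ≠ b k → (colW n A (b k + 1) n : ℝ) ≤ c

/-- `R` is an axis-aligned rectangle: the product of a contiguous row interval and a
contiguous column interval (possibly empty). -/
def IsRect (R : Finset (ℕ × ℕ)) : Prop :=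
  ∃ r₁ r₂ c₁ c₂ : ℕ, R = Finset.Icc r₁ r₂ ×ˢ Finset.Icc c₁ c₂

/-- The set of cells `S` can be tiled with at most `N` pairwise disjoint axis-aligned
rectangles whose union is `S` and each of whose weights (sum of entries of `A`) is at
most `c`. -/
def TiledBy (A : ℕ → ℕ → ℕ) (S : Finset (ℕ × ℕ)) (N : ℕ) (c : ℝ) : Prop :=
  ∃ T : Finset (Finset (ℕ × ℕ)), T.card ≤ N ∧ (∀ R ∈ T, IsRect R) ∧
    (T : Set (Finset (ℕ × ℕ))).PairwiseDisjoint id ∧ T.sup id = S ∧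
    ∀ R ∈ T, (∑ p ∈ R, (A p.1 p.2 : ℝ)) ≤ c

/-- The full grid of cells `{1,…,n} × {1,…,n}`. -/
def grid (n : ℕ) : Finset (ℕ × ℕ) := Finset.Icc 1 n ×ˢ Finset.Icc 1 n

theorem HorizPartition.mono_tiles {n : ℕ} {A : ℕ → ℕ → ℕ} {i j m m' : ℕ} {c : ℝ} (hc : 0 < c)
    (hm : m ≤ m') (h : HorizPartition n A i j m c) : HorizPartition n A i j m' c := by
  obtain ⟨f, hf, h0, hn, hw⟩ := h
  refine ⟨fun s => f (min s m), ?_, ?_, ?_, ?_⟩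
  · intro a b hab
    exact hf (min_le_min_right m hab)
  · simpa using h0
  · simpa [min_eq_right hm] using hn
  · intro t _
    by_cases ht : t < m
    · have h1 : min t m = t := by omega
      have h2 : min (t + 1) m = t + 1 := by omega
      simp only [h1, h2]
      exact hw t ht
    · have h1 : min t m = m := by omega
      have h2 : min (t + 1) m = m := by omega
      simp only [h1, h2, Finset.Ioc_self, Finset.sum_empty]
      exact hc.le

/-- In a maximal sequence of vertical boundaries `b₁ < … < b_k` with
shadows `sh` and types `t` w.r.t. a threshold `c > 0`: for every `2 ≤ i ≤ k`, if
`sh i ≠ b i` then `t i > t (i−1)` or `sh (i−1) ≠ b (i−1)`. -/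
theorem stmt4 (n : ℕ) (A : ℕ → ℕ → ℕ) (hA : Binary A) (c : ℝ) (hc : 0 < c)
    (k : ℕ) (B : VBoundaries n A c k) :
    ∀ i, 2 ≤ i → i ≤ k → B.sh i ≠ B.b i →
      B.t (i - 1) < B.t i ∨ B.sh (i - 1) ≠ B.b (i - 1) := by
  intro i hi hik hne
  obtain ⟨l, rfl⟩ : ∃ l, i = l + 1 := ⟨i - 1, by omega⟩
  simp only [Nat.add_sub_cancel]
  by_contra hcon
  push Not at hcon
  obtain ⟨ht, hs⟩ := hcon
  apply hne
  rw [B.shadow_succ l (by omega) (by omega), hs]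
  intro hp
  exact (B.step_eq l (by omega) (by omega) hs).2 (hp.mono_tiles hc ht)
end

section
/- Let A be an n×n binary array with a maximal sequence of vertical boundaries b₁ < … < b_k (k ≥ 1) with shadows b'₁, …, b'_k and types t₁, …, t_k with respect to a real threshold c > 0, and let T_v = t₁ + … + t_k. Then A can be tiled into at most T_v + 1 tiles each of weight at most c. -/
theorem tiled_mono {A : ℕ → ℕ → ℕ} {S : Finset (ℕ × ℕ)} {N M : ℕ} {c : ℝ}
    (h : TiledBy A S N c) (hNM : N ≤ M) : TiledBy A S M c := by
  obtain ⟨T, h1, h2⟩ := h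
  exact ⟨T, h1.trans hNM, h2⟩

theorem tiled_union {A : ℕ → ℕ → ℕ} {S S' : Finset (ℕ × ℕ)} {N N' : ℕ} {c : ℝ}
    (h : TiledBy A S N c) (h' : TiledBy A S' N' c) (hd : Disjoint S S') :
    TiledBy A (S ∪ S') (N + N') c := by
  classical
  obtain ⟨T, h1, h2, h3, h4, h5⟩ := h
  obtain ⟨T', h1', h2', h3', h4', h5'⟩ := h'
  refine ⟨T ∪ T', (Finset.card_union_le _ _).trans (by omega), ?_, ?_, ?_, ?_⟩
  · intro R hR
    rcases Finset.mem_union.1 hR with hR | hR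
    · exact h2 R hR
    · exact h2' R hR
  · have key : ∀ R ∈ T, ∀ R' ∈ T', Disjoint R R' := by
      intro R hR R' hR'
      have a : R ≤ S := h4 ▸ Finset.le_sup (f := id) hR
      have b : R' ≤ S' := h4' ▸ Finset.le_sup (f := id) hR'
      exact hd.mono a b
    intro R hR R' hR' hne
    have hR := Finset.mem_union.1 (Finset.mem_coe.1 hR)
    have hR' := Finset.mem_union.1 (Finset.mem_coe.1 hR')
    rcases hR with hR | hR <;> rcases hR' with hR' | hR'
    · exact h3 hR hR' hne
    · exact key R hR R' hR'
    · exact (key R' hR' R hR).symm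
    · exact h3' hR hR' hne
  · rw [Finset.sup_union, h4, h4']; rfl
  · intro R hR
    rcases Finset.mem_union.1 hR with hR | hR
    · exact h5 R hR
    · exact h5' R hR

theorem tiled_single {A : ℕ → ℕ → ℕ} {S : Finset (ℕ × ℕ)} {c : ℝ} (hS : IsRect S)
    (h : (∑ p ∈ S, (A p.1 p.2 : ℝ)) ≤ c) : TiledBy A S 1 c := by
  refine ⟨{S}, by simp, by simpa using hS, by simp, by simp, by simpa using h⟩

theorem tiled_col {n : ℕ} {A : ℕ → ℕ → ℕ} {i j : ℕ} {c : ℝ}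
    (h : (colW n A i j : ℝ) ≤ c) :
    TiledBy A (Finset.Icc 1 n ×ˢ Finset.Icc i j) 1 c := by
  refine tiled_single ⟨_, _, _, _, rfl⟩ ?_
  rw [Finset.sum_product]
  simpa [colW] using h

theorem tiled_horiz {n : ℕ} {A : ℕ → ℕ → ℕ} {i j m : ℕ} {c : ℝ}
    (h : HorizPartition n A i j m c) :
    TiledBy A (Finset.Icc 1 n ×ˢ Finset.Icc i j) m c := by
  obtain ⟨f, hf, h0, hm, hw⟩ := h
  have key : ∀ s ≤ m, TiledBy A (Finset.Icc 1 (f s) ×ˢ Finset.Icc i j) s c := by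
    intro s
    induction s with
    | zero =>
      intro _
      refine ⟨∅, by simp, by simp, by simp, by simp [h0], by simp⟩
    | succ s ih =>
      intro hs
      have h1 := ih (by omega)
      have hfs := hf (Nat.le_succ s)
      have h2 : TiledBy A (Finset.Icc (f s + 1) (f (s+1)) ×ˢ Finset.Icc i j) 1 c := by
        refine tiled_single ⟨_, _, _, _, rfl⟩ ?_
        rw [Finset.sum_product]
        have := hw s (by omega)
        have e : Finset.Icc (f s + 1) (f (s+1)) = Finset.Ioc (f s) (f (s+1)) := by
          ext x; simp
        rw [e]; exact this
      have h3 := tiled_union h1 h2 (by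
        rw [Finset.disjoint_left]; rintro ⟨x, y⟩; simp; omega)
      convert h3 using 1
      ext ⟨x, y⟩; simp at hfs ⊢; omega
  have := key m le_rfl
  rwa [hm] at this

theorem tiled_append {n : ℕ} {A : ℕ → ℕ → ℕ} {s e N M K : ℕ} {c : ℝ}
    (h : TiledBy A (Finset.Icc 1 n ×ˢ Finset.Ico 1 s) N c)
    (h' : TiledBy A (Finset.Icc 1 n ×ˢ Finset.Icc s e) M c)
    (h1 : 1 ≤ s) (h2 : s ≤ e + 1) (hK : N + M ≤ K) :
    TiledBy A (Finset.Icc 1 n ×ˢ Finset.Ico 1 (e + 1)) K c := by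
  have h3 := tiled_union h h' (by
    rw [Finset.disjoint_left]; rintro ⟨x, y⟩; simp; omega)
  refine tiled_mono ?_ hK
  convert h3 using 1
  ext ⟨x, y⟩; simp; omega

/-- **Lemma 'tiling'.** If the `n×n` binary array `A` has a maximal
sequence of `k ≥ 1` vertical boundaries with types `t₁, …, t_k` w.r.t. the threshold
`c > 0`, and `T_v = t₁ + … + t_k`, then `A` can be tiled into at most `T_v + 1`
axis-aligned rectangular tiles each of weight at most `c`. -/
theorem stmt5 (n : ℕ) (A : ℕ → ℕ → ℕ) (hA : Binary A) (c : ℝ) (hc : 0 < c)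
    (k : ℕ) (hk : 1 ≤ k) (B : VBoundaries n A c k) :
    TiledBy A (grid n) ((∑ i ∈ Finset.Icc 1 k, B.t i) + 1) c := by
  have tpos : ∀ i, 1 ≤ i → i ≤ k → 1 ≤ B.t i := by
    intro i h1 h2
    rw [B.type_def i h1 h2]; omega
  have hempty : TiledBy A (Finset.Icc 1 n ×ˢ Finset.Ico 1 1) 0 c :=
    ⟨∅, by simp, by simp, by simp, by simp, by simp⟩
  have key : ∀ i, 1 ≤ i → i ≤ k → 1 ≤ B.b i ∧
      (B.sh i ≠ B.b i → TiledBy A (Finset.Icc 1 n ×ˢ Finset.Ico 1 (B.sh i))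
        (∑ j ∈ Finset.Icc 1 i, B.t j) c) ∧
      (B.sh i = B.b i → TiledBy A (Finset.Icc 1 n ×ˢ Finset.Ico 1 (B.sh i))
        (∑ j ∈ Finset.Icc 1 (i - 1), B.t j + 1) c) := by
    intro i hi
    induction i, hi using Nat.le_induction with
    | base =>
      intro _
      have hb := B.one_le_b
      refine ⟨hb, fun hne => ?_, fun he => ?_⟩
      · have hp := not_not.1 (fun h => hne (B.shadow_one.2 h))
        have hs : B.sh 1 = B.b 1 + 1 := (B.shadow_mem 1 le_rfl hk).resolve_left hne
        rw [hs]
        exact tiled_append hempty (tiled_horiz hp) le_rfl (by omega) (by simp)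
      · have := tiled_append (K := 1) hempty (tiled_col B.first_le) le_rfl (by omega) (by simp)
        rw [Nat.sub_add_cancel hb] at this
        rw [he]; simpa using this
    | succ i hi ih =>
      intro hik
      obtain ⟨hb, hN, hE⟩ := ih (by omega)
      have hlt := B.strict i hi (by omega)
      have hti := tpos i hi (by omega)
      have hsi := B.shadow_mem i hi (by omega)
      have hsum : ∑ j ∈ Finset.Icc 1 (i + 1), B.t j =
          ∑ j ∈ Finset.Icc 1 i, B.t j + B.t (i + 1) := Finset.sum_Icc_succ_top (by omega) _
      have hsum' : ∑ j ∈ Finset.Icc 1 i, B.t j =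
          ∑ j ∈ Finset.Icc 1 (i - 1), B.t j + B.t i := by
        obtain ⟨m, rfl⟩ : ∃ m, i = m + 1 := ⟨i - 1, by omega⟩
        exact Finset.sum_Icc_succ_top (by omega) _
      refine ⟨by omega, fun hne => ?_, fun he => ?_⟩
      · have hp := not_not.1 (fun h => hne ((B.shadow_succ i hi (by omega)).2 h))
        have hs := (B.shadow_mem (i + 1) (by omega) hik).resolve_left hne
        rw [hs]
        by_cases hc' : B.sh i = B.b i
        · exact tiled_append (hE hc') (tiled_horiz hp) (by omega) (by omega) (by omega)
        · exact tiled_append (hN hc') (tiled_horiz hp) (by omega) (by omega) (by omega)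
      · have e : B.sh (i + 1) = B.b (i + 1) - 1 + 1 := by omega
        rw [e, Nat.add_sub_cancel]
        by_cases hc' : B.sh i = B.b i
        · have hp := (B.step_eq i hi (by omega) hc').1
          rw [← hc'] at hp
          exact tiled_append (hE hc') (tiled_horiz hp) (by omega) (by omega) (by omega)
        · have hp := (B.step_ne i hi (by omega) hc').1
          rw [← hsi.resolve_left hc'] at hp
          exact tiled_append (hN hc') (tiled_col hp) (by omega) (by omega) (by omega)
  obtain ⟨hb, hN, hE⟩ := key k hk le_rfl
  have hbn := B.b_le_n
  have hsk := B.shadow_mem k hk le_rfl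
  have hsum' : ∑ j ∈ Finset.Icc 1 k, B.t j =
      ∑ j ∈ Finset.Icc 1 (k - 1), B.t j + B.t k := by
    obtain ⟨m, rfl⟩ : ∃ m, k = m + 1 := ⟨k - 1, by omega⟩
    exact Finset.sum_Icc_succ_top (by omega) _
  have hg : grid n = Finset.Icc 1 n ×ˢ Finset.Ico 1 (n + 1) := by
    ext ⟨x, y⟩; simp [grid]
  rw [hg]
  by_cases hc' : B.sh k = B.b k
  · have hp := B.max_eq hc'
    rw [← hc'] at hp
    exact tiled_append (hE hc') (tiled_horiz hp) (by omega) (by omega) (by omega)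
  · have hp := B.max_ne hc'
    rw [← hsk.resolve_left hc'] at hp
    exact tiled_append (hN hc') (tiled_col hp) (by omega) (by omega) (by omega)
end

section
/- Let A be an n×n binary array with total weight w(A) > 0, let p be a positive integer, L > 0 a real number, β = p²/w(A) and c = (3/2 + β)·L. Suppose A has a maximal sequence of vertical boundaries (k ≥ 1 boundaries, type sum T_v) and a maximal sequence of horizontal boundaries (l ≥ 1 boundaries, type sum T_h) with respect to the threshold c, and let T = min(T_v, T_h). If w(A) ≤ p·L and T ≤ p, then w(A) > T·L. -/
lemma colW_split (n : ℕ) (A : ℕ → ℕ → ℕ) (i j m : ℕ) (h1 : i ≤ j + 1) (h2 : j ≤ m) :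
    colW n A i m = colW n A i j + colW n A (j + 1) m := by
  unfold colW
  rw [← Finset.sum_add_distrib]
  refine Finset.sum_congr rfl fun r _ => ?_
  have hU : Finset.Icc i m = Finset.Icc i j ∪ Finset.Icc (j + 1) m := by
    ext x; simp only [Finset.mem_union, Finset.mem_Icc]; omega
  have hD : Disjoint (Finset.Icc i j) (Finset.Icc (j + 1) m) := by
    rw [Finset.disjoint_left]; intro x; simp only [Finset.mem_Icc]; omega
  rw [hU, Finset.sum_union hD]

lemma colW_last (n : ℕ) (A : ℕ → ℕ → ℕ) (i y : ℕ) (h1 : i ≤ y) (h2 : 1 ≤ y) :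
    colW n A i y = colW n A i (y - 1) + colW n A y y := by
  have := colW_split n A i (y - 1) y (by omega) (by omega)
  rwa [Nat.sub_add_cancel h2] at this

lemma colW_first (n : ℕ) (A : ℕ → ℕ → ℕ) (i y : ℕ) (h1 : i ≤ y) :
    colW n A i y = colW n A i i + colW n A (i + 1) y :=
  colW_split n A i i y (by omega) h1

lemma Ioc_sum_eq (n : ℕ) (A : ℕ → ℕ → ℕ) (i j : ℕ) :
    (∑ r ∈ Finset.Ioc 0 n, ∑ col ∈ Finset.Icc i j, (A r col : ℝ)) = (colW n A i j : ℝ) := by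
  unfold colW
  push_cast
  rfl

lemma not_part_one (n : ℕ) (A : ℕ → ℕ → ℕ) (i j : ℕ) (c : ℝ)
    (h : ¬ HorizPartition n A i j 1 c) : c < (colW n A i j : ℝ) := by
  by_contra hc
  push Not at hc
  apply h
  refine ⟨fun x => if x = 0 then 0 else n, ?_, by simp, by simp, ?_⟩
  · intro x y hxy
    dsimp only
    split_ifs <;> omega
  · intro t ht
    obtain rfl : t = 0 := by omega
    simpa [Ioc_sum_eq] using hc

lemma not_part_two (n : ℕ) (A : ℕ → ℕ → ℕ) (hA : Binary A) (i j m : ℕ) (c : ℝ) (hc : 0 ≤ c)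
    (him : i ≤ m) (hmj : m ≤ j)
    (h : ¬ HorizPartition n A i j 2 c) :
    2 * c < 2 * (colW n A i j : ℝ) - (colW n A m m : ℝ) + 1 := by
  set R : ℕ → ℝ := fun r => ∑ col ∈ Finset.Icc i j, (A r col : ℝ) with hR
  have hRnn : ∀ r, 0 ≤ R r := fun r => Finset.sum_nonneg fun _ _ => by positivity
  have key : ∀ x, x ≤ n → ¬ ((∑ r ∈ Finset.Ioc 0 x, R r) ≤ c ∧ (∑ r ∈ Finset.Ioc x n, R r) ≤ c) := by
    rintro x hx ⟨h1, h2⟩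
    apply h
    refine ⟨fun y => if y = 0 then 0 else if y = 1 then x else n, ?_, by simp, by simp, ?_⟩
    · intro y z hyz
      dsimp only
      split_ifs <;> omega
    · intro t ht
      have : t = 0 ∨ t = 1 := by omega
      rcases this with rfl | rfl
      · simpa using h1
      · simpa using h2
  have hex : ∃ x, x < n ∧ (∑ r ∈ Finset.Ioc 0 x, R r) ≤ c ∧ c < ∑ r ∈ Finset.Ioc 0 (x + 1), R r := by
    by_contra hne
    push Not at hne
    have : ∀ x, x ≤ n → (∑ r ∈ Finset.Ioc 0 x, R r) ≤ c := by
      intro x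
      induction x with
      | zero => intro _; simpa using hc
      | succ x ih => intro hx; exact hne x (by omega) (ih (by omega))
    exact key n le_rfl ⟨this n le_rfl, by simpa using hc⟩
  obtain ⟨x, hxn, hx1, hx2⟩ := hex
  have hx3 : c < ∑ r ∈ Finset.Ioc x n, R r := by
    by_contra hcon
    exact key x hxn.le ⟨hx1, not_lt.mp hcon⟩
  have hsplit : (∑ r ∈ Finset.Ioc 0 x, R r) + (∑ r ∈ Finset.Ioc x n, R r) = (colW n A i j : ℝ) := by
    rw [← Ioc_sum_eq]
    exact Finset.sum_Ioc_consecutive R (Nat.zero_le x) hxn.le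
  have hsucc : (∑ r ∈ Finset.Ioc 0 (x + 1), R r) = (∑ r ∈ Finset.Ioc 0 x, R r) + R (x + 1) :=
    Finset.sum_Ioc_succ_top (Nat.zero_le x) R
  -- the heavy row
  have hcol : (colW n A m m : ℝ) = ∑ r ∈ Finset.Ioc 0 n, (A r m : ℝ) := by
    rw [← Ioc_sum_eq]; simp
  have hdiff : R (x + 1) - (A (x + 1) m : ℝ) ≤ (colW n A i j : ℝ) - colW n A m m := by
    rw [hcol, ← Ioc_sum_eq, ← Finset.sum_sub_distrib]
    refine Finset.single_le_sum (f := fun r => R r - (A r m : ℝ)) ?_ ?_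
    · intro r _
      have : (A r m : ℝ) ≤ R r :=
        Finset.single_le_sum (f := fun col => (A r col : ℝ)) (fun _ _ => by positivity)
          (Finset.mem_Icc.mpr ⟨him, hmj⟩)
      simpa using this
    · simp only [Finset.mem_Ioc]; omega
  have hone : (A (x + 1) m : ℝ) ≤ 1 := by exact_mod_cast hA (x + 1) m
  linarith

/-- The invariant along the boundary sequence. -/
lemma boundary_inv (n : ℕ) (A : ℕ → ℕ → ℕ) (hA : Binary A) (c : ℝ) (hc : 1 ≤ c) (k : ℕ)
    (B : VBoundaries n A c k) (i : ℕ) (hi : 1 ≤ i) (hik : i ≤ k) :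
    1 ≤ B.b i ∧
    ∃ P : ℝ, P = (colW n A 1 (B.b i) : ℝ) + ∑ j ∈ Finset.Icc 1 i, (colW n A (B.b j) (B.b j) : ℝ)
      - (∑ j ∈ Finset.Icc 1 i, (B.t j : ℝ)) * (c - 1 / 3) ∧
    0 ≤ P ∧ (B.t i = 1 → (colW n A (B.b i) (B.b i) : ℝ) ≤ P) ∧
    (B.t i = 2 → B.sh i = B.b i →
      3 / 2 * (colW n A (B.b i) (B.b i) : ℝ) - c - 1 / 2 + 2 / 3 ≤ P) ∧
    (3 ≤ B.t i → c ≤ P) := by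
  have hc0 : 0 < c := by linarith
  have ht1 : ∀ i, 1 ≤ i → i ≤ k → 1 ≤ B.t i := fun i h1 h2 => by
    rw [B.type_def i h1 h2]; omega
  have htw : ∀ i, 1 ≤ i → i ≤ k → ((B.t i : ℝ) - 1) * c ≤ (colW n A (B.b i) (B.b i) : ℝ) := by
    intro i h1 h2
    rw [B.type_def i h1 h2]
    push_cast
    have := Nat.floor_le (a := (colW n A (B.b i) (B.b i) : ℝ) / c) (by positivity)
    rw [le_div_iff₀ hc0] at this
    linarith
  -- the generic step
  have step : ∀ (P G w P' : ℝ) (t : ℕ) (q : Prop), 1 ≤ t → ((t : ℝ) - 1) * c ≤ w → 0 ≤ G → 0 ≤ P →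
      P' = P + G + 2 * w - t * (c - 1 / 3) →
      (t = 1 → c - 1 / 3 ≤ P + G + w) → (t = 2 → q → c - 1 / 2 ≤ P + G + w / 2) →
      (0 ≤ P' ∧ (t = 1 → w ≤ P') ∧ (t = 2 → q → 3 / 2 * w - c - 1 / 2 + 2 / 3 ≤ P') ∧
        (3 ≤ t → c ≤ P')) := by
    intro P G w P' t q h1 htw hG hP hP' ha hb
    have h3 : 3 ≤ t → c ≤ P' := by
      intro h
      have h' : (3 : ℝ) ≤ t := by exact_mod_cast h
      nlinarith
    refine ⟨?_, ?_, ?_, h3⟩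
    · have : t = 1 ∨ t = 2 ∨ 3 ≤ t := by omega
      rcases this with h | h | h
      · have := ha h; subst h; push_cast at *; linarith
      · subst h; push_cast at *; linarith
      · linarith [h3 h]
    · intro h; have := ha h; subst h; push_cast at *; linarith
    · intro h hq; have := hb h hq; subst h; push_cast at *; linarith
  induction i, hi using Nat.le_induction with
  | base =>
    refine ⟨B.one_le_b, _, rfl, ?_⟩
    have hl := colW_last n A 1 (B.b 1) B.one_le_b B.one_le_b
    have hlR : (colW n A 1 (B.b 1) : ℝ) = colW n A 1 (B.b 1 - 1) + colW n A (B.b 1) (B.b 1) := by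
      exact_mod_cast hl
    have hgt := B.first_gt
    refine step 0 (colW n A 1 (B.b 1 - 1)) _ _ _ (B.sh 1 = B.b 1) (ht1 1 le_rfl hik)
      (htw 1 le_rfl hik) (by positivity) le_rfl ?_ ?_ ?_
    · simp only [Finset.Icc_self, Finset.sum_singleton]; rw [hlR]; ring
    · intro _; linarith
    · intro h2 hs
      have hn := B.shadow_one.mp hs
      rw [h2] at hn
      have := not_part_two n A hA 1 (B.b 1) (B.b 1) c hc0.le B.one_le_b le_rfl hn
      linarith
  | succ i hi ih =>
    obtain ⟨hb1, P, hPdef, hP0, hPa, hPb, hPc⟩ := ih (by omega)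
    have hik' : i < k := by omega
    have hlt := B.strict i hi hik'
    refine ⟨by omega, _, rfl, ?_⟩
    have e1 : (colW n A 1 (B.b (i + 1)) : ℝ) = colW n A 1 (B.b i) + colW n A (B.b i + 1) (B.b (i + 1)) := by
      exact_mod_cast colW_split n A 1 (B.b i) (B.b (i + 1)) (by omega) hlt.le
    have e2 : (colW n A (B.b i + 1) (B.b (i + 1)) : ℝ) =
        colW n A (B.b i + 1) (B.b (i + 1) - 1) + colW n A (B.b (i + 1)) (B.b (i + 1)) := by
      exact_mod_cast colW_last n A (B.b i + 1) (B.b (i + 1)) (by omega) (by omega)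
    have e3 : (colW n A (B.b i) (B.b (i + 1)) : ℝ) =
        colW n A (B.b i) (B.b i) + colW n A (B.b i + 1) (B.b (i + 1)) := by
      exact_mod_cast colW_first n A (B.b i) (B.b (i + 1)) hlt.le
    have hwi := htw i hi hik'.le
    have hti := ht1 i hi hik'.le
    have htc : B.t i = 1 ∨ B.t i = 2 ∨ 3 ≤ B.t i := by omega
    have hG0 : (0 : ℝ) ≤ colW n A (B.b i + 1) (B.b (i + 1) - 1) := by positivity
    have hw0 : (0 : ℝ) ≤ colW n A (B.b (i + 1)) (B.b (i + 1)) := by positivity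
    have hw' := htw (i + 1) (by omega) hik
    refine step P (colW n A (B.b i + 1) (B.b (i + 1) - 1)) _ _ _ (B.sh (i + 1) = B.b (i + 1))
      (ht1 (i + 1) (by omega) hik) hw' hG0 hP0 ?_ ?_ ?_
    · rw [Finset.sum_Icc_succ_top (by omega), Finset.sum_Icc_succ_top (by omega), hPdef, e1, e2]
      ring
    · intro h1
      by_cases hs : B.sh i = B.b i
      · have hn := (B.step_eq i hi hik' hs).2
        rcases htc with h | h | h
        · rw [h] at hn
          have := not_part_one _ _ _ _ _ hn
          have := hPa h
          linarith
        · have := hPb h hs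
          rw [h] at hn hwi
          have := not_part_two n A hA (B.b i) (B.b (i + 1)) (B.b i) c hc0.le le_rfl hlt.le hn
          push_cast at hwi
          linarith
        · linarith [hPc h]
      · have := (B.step_ne i hi hik' hs).2
        linarith
    · intro h2 hs2
      have hn := (B.shadow_succ i hi hik').mp hs2
      rw [h2] at hn hw'
      push_cast at hw'
      rcases B.shadow_mem i hi hik'.le with hs | hs
      · rw [hs] at hn
        rcases htc with h | h | h
        · have := hPa h
          have := not_part_two n A hA (B.b i) (B.b (i + 1)) (B.b (i + 1)) c hc0.le hlt.le le_rfl hn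
          linarith
        · have := hPb h hs
          rw [h] at hwi
          push_cast at hwi
          linarith
        · linarith [hPc h]
      · rw [hs] at hn
        have := not_part_two n A hA (B.b i + 1) (B.b (i + 1)) (B.b (i + 1)) c hc0.le hlt le_rfl hn
        linarith

/-- For each `T ≤ T_v` there is a set of at most `T` columns that are heavy. -/
lemma exists_cols (n : ℕ) (A : ℕ → ℕ → ℕ) (hA : Binary A) (c : ℝ) (hc : 1 ≤ c) (k : ℕ) (hk : 1 ≤ k)
    (B : VBoundaries n A c k) (T : ℕ) (hT : 1 ≤ T) (hTB : T ≤ ∑ i ∈ Finset.Icc 1 k, B.t i) :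
    ∃ V : Finset ℕ, V ⊆ Finset.Icc 1 n ∧ V.card ≤ T ∧
      (T : ℝ) * (c - 1 / 3) ≤ (colW n A 1 n : ℝ) + ∑ v ∈ V, (colW n A v v : ℝ) := by
  have hmono : ∀ i j, 1 ≤ i → i < j → j ≤ k → B.b i < B.b j := by
    intro i j hi hij hj
    induction j, hij using Nat.le_induction with
    | base => exact B.strict i hi (by omega)
    | succ j hij' ih =>
      have h1 := ih (by omega)
      have h2 := B.strict j (by omega) (by omega)
      omega
  have hle : ∀ i, 1 ≤ i → i ≤ k → B.b i ≤ n := by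
    intro i hi hik
    rcases hik.eq_or_lt with rfl | h
    · exact B.b_le_n
    · have := hmono i k hi h le_rfl
      have := B.b_le_n
      omega
  have hpos : ∀ i, 1 ≤ i → i ≤ k → 1 ≤ B.t i := fun i h1 h2 => by
    rw [B.type_def i h1 h2]; omega
  obtain ⟨m, hm1, hmk, hmT, hmS⟩ : ∃ m, 1 ≤ m ∧ m ≤ k ∧ m ≤ T ∧ T ≤ ∑ i ∈ Finset.Icc 1 m, B.t i := by
    by_cases h : k ≤ T
    · exact ⟨k, hk, le_rfl, h, hTB⟩
    · refine ⟨T, hT, by omega, le_rfl, ?_⟩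
      calc T = ∑ i ∈ Finset.Icc 1 T, 1 := by simp
        _ ≤ _ := Finset.sum_le_sum fun i hi => by
          rw [Finset.mem_Icc] at hi
          exact hpos i hi.1 (by omega)
  obtain ⟨_, P, hP, hP0, _⟩ := boundary_inv n A hA c hc k B m hm1 hmk
  have hinj : Set.InjOn B.b (Finset.Icc 1 m : Finset ℕ) := by
    intro x hx y hy hxy
    simp only [Finset.coe_Icc, Set.mem_Icc] at hx hy
    rcases lt_trichotomy x y with h | h | h
    · have := hmono x y hx.1 h (by omega); omega
    · exact h
    · have := hmono y x hy.1 h (by omega); omega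
  refine ⟨(Finset.Icc 1 m).image B.b, ?_, ?_, ?_⟩
  · intro v hv
    obtain ⟨i, hi, rfl⟩ := Finset.mem_image.mp hv
    rw [Finset.mem_Icc] at hi ⊢
    exact ⟨(boundary_inv n A hA c hc k B i hi.1 (by omega)).1, hle i hi.1 (by omega)⟩
  · refine Finset.card_image_le.trans ?_
    simpa using hmT
  · rw [Finset.sum_image hinj]
    have h1 : (colW n A 1 n : ℝ) = colW n A 1 (B.b m) + colW n A (B.b m + 1) n := by
      exact_mod_cast colW_split n A 1 (B.b m) n (by omega) (hle m hm1 hmk)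
    have h2 : (0 : ℝ) ≤ colW n A (B.b m + 1) n := by positivity
    have h3 : (T : ℝ) ≤ ∑ j ∈ Finset.Icc 1 m, (B.t j : ℝ) := by exact_mod_cast hmS
    have h4 : (T : ℝ) * (c - 1 / 3) ≤ (∑ j ∈ Finset.Icc 1 m, (B.t j : ℝ)) * (c - 1 / 3) :=
      mul_le_mul_of_nonneg_right h3 (by linarith)
    linarith

lemma cross_bound (n : ℕ) (A : ℕ → ℕ → ℕ) (hA : Binary A) (V H : Finset ℕ)
    (hV : V ⊆ Finset.Icc 1 n) (hH : H ⊆ Finset.Icc 1 n) :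
    ∑ v ∈ V, colW n A v v + ∑ h ∈ H, colW n (fun r col => A col r) h h
      ≤ colW n A 1 n + H.card * V.card := by
  have e1 : ∑ v ∈ V, colW n A v v =
      ∑ r ∈ Finset.Icc 1 n, ∑ x ∈ Finset.Icc 1 n, (if x ∈ V then A r x else 0) := by
    simp only [colW, Finset.Icc_self, Finset.sum_singleton]
    rw [Finset.sum_comm]
    refine Finset.sum_congr rfl fun r _ => ?_
    rw [← Finset.sum_filter, Finset.filter_mem_eq_inter, Finset.inter_eq_right.mpr hV]
  have e2 : ∑ h ∈ H, colW n (fun r col => A col r) h h =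
      ∑ r ∈ Finset.Icc 1 n, ∑ x ∈ Finset.Icc 1 n, (if r ∈ H then A r x else 0) := by
    simp only [colW, Finset.Icc_self, Finset.sum_singleton]
    rw [Finset.sum_comm, Finset.sum_comm (s := Finset.Icc 1 n) (t := Finset.Icc 1 n)]
    refine Finset.sum_congr rfl fun x _ => ?_
    rw [← Finset.sum_filter, Finset.filter_mem_eq_inter, Finset.inter_eq_right.mpr hH]
  have e3 : H.card * V.card =
      ∑ r ∈ Finset.Icc 1 n, ∑ x ∈ Finset.Icc 1 n,
        ((if r ∈ H then 1 else 0) * (if x ∈ V then 1 else 0)) := by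
    rw [← Finset.sum_mul_sum, ← Finset.sum_filter, ← Finset.sum_filter,
      Finset.filter_mem_eq_inter, Finset.filter_mem_eq_inter, Finset.inter_eq_right.mpr hH,
      Finset.inter_eq_right.mpr hV]
    simp
  rw [e1, e2, e3]
  unfold colW
  rw [← Finset.sum_add_distrib, ← Finset.sum_add_distrib]
  refine Finset.sum_le_sum fun r _ => ?_
  rw [← Finset.sum_add_distrib, ← Finset.sum_add_distrib]
  refine Finset.sum_le_sum fun x _ => ?_
  have := hA r x
  split_ifs <;> omega

lemma main_aux (n : ℕ) (A : ℕ → ℕ → ℕ) (hA : Binary A)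
    (hw : 0 < colW n A 1 n) (p : ℕ) (hp : 0 < p) (L : ℝ) (hL : 0 < L)
    (k l : ℕ) (hk : 1 ≤ k) (hl : 1 ≤ l) (c : ℝ) (hcp : 3 / 2 * L + p ≤ c)
    (B : VBoundaries n A c k)
    (C : VBoundaries n (fun r col => A col r) c l)
    (hTp : min (∑ i ∈ Finset.Icc 1 k, B.t i) (∑ i ∈ Finset.Icc 1 l, C.t i) ≤ p) :
    (colW n A 1 n : ℝ) >
      (min (∑ i ∈ Finset.Icc 1 k, B.t i) (∑ i ∈ Finset.Icc 1 l, C.t i) : ℕ) * L := by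
  set w : ℝ := (colW n A 1 n : ℝ) with hwdef
  have hw0 : 0 < w := by rw [hwdef]; exact_mod_cast hw
  set T := min (∑ i ∈ Finset.Icc 1 k, B.t i) (∑ i ∈ Finset.Icc 1 l, C.t i) with hTdef
  have hp1 : (1 : ℝ) ≤ p := by exact_mod_cast hp
  have hc1 : 1 ≤ c := by linarith
  have hT1 : 1 ≤ T := by
    refine le_min ?_ ?_
    · refine le_trans ?_ (Finset.single_le_sum (f := B.t) (fun _ _ => Nat.zero_le _)
        (Finset.mem_Icc.mpr ⟨le_rfl, hk⟩))
      rw [B.type_def 1 le_rfl hk]; omega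
    · refine le_trans ?_ (Finset.single_le_sum (f := C.t) (fun _ _ => Nat.zero_le _)
        (Finset.mem_Icc.mpr ⟨le_rfl, hl⟩))
      rw [C.type_def 1 le_rfl hl]; omega
  have hA' : Binary (fun r col => A col r) := fun r x => hA x r
  obtain ⟨V, hV, hVc, hVw⟩ := exists_cols n A hA c hc1 k hk B T hT1 (min_le_left _ _)
  obtain ⟨H, hH, hHc, hHw⟩ := exists_cols n _ hA' c hc1 l hl C T hT1 (min_le_right _ _)
  have htr : colW n (fun r col => A col r) 1 n = colW n A 1 n := by
    unfold colW; exact Finset.sum_comm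
  rw [htr] at hHw
  have hx := cross_bound n A hA V H hV hH
  have hx2 : ∑ v ∈ V, colW n A v v + ∑ h ∈ H, colW n (fun r col => A col r) h h
      ≤ colW n A 1 n + T * T := hx.trans (Nat.add_le_add_left (Nat.mul_le_mul hHc hVc) _)
  have hx3 : ∑ v ∈ V, (colW n A v v : ℝ) + ∑ h ∈ H, (colW n (fun r col => A col r) h h : ℝ)
      ≤ w + T * T := by rw [hwdef]; exact_mod_cast hx2
  have hTr : (1 : ℝ) ≤ T := by exact_mod_cast hT1
  have hTpr : (T : ℝ) ≤ p := by exact_mod_cast hTp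
  have h5 : (T : ℝ) * (3 / 2 * L + T - 1 / 3) ≤ T * (c - 1 / 3) :=
    mul_le_mul_of_nonneg_left (by linarith) (by linarith)
  rw [← hwdef] at hVw hHw
  nlinarith

/-- **Lemma 7, weight lower bound.** Let `A` be an `n×n` binary array with
total weight `w(A) > 0`, `p` a positive integer, `L > 0` real, `β = p²/w(A)` and
`c = (3/2 + β)·L`. Suppose `A` has a maximal sequence of `k ≥ 1` vertical boundaries
(type sum `T_v`) and a maximal sequence of `l ≥ 1` horizontal boundaries (type sum
`T_h`) w.r.t. the threshold `c`, and let `T = min(T_v, T_h)`. If `w(A) ≤ p·L` and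
`T ≤ p`, then `w(A) > T·L`. -/
theorem stmt8 (n : ℕ) (A : ℕ → ℕ → ℕ) (hA : Binary A)
    (hw : 0 < colW n A 1 n) (p : ℕ) (hp : 0 < p) (L : ℝ) (hL : 0 < L)
    (k l : ℕ) (hk : 1 ≤ k) (hl : 1 ≤ l)
    (B : VBoundaries n A ((3 / 2 + (p : ℝ) ^ 2 / (colW n A 1 n : ℝ)) * L) k)
    (C : VBoundaries n (fun r col => A col r)
          ((3 / 2 + (p : ℝ) ^ 2 / (colW n A 1 n : ℝ)) * L) l)
    (hwp : (colW n A 1 n : ℝ) ≤ (p : ℝ) * L)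
    (hTp : min (∑ i ∈ Finset.Icc 1 k, B.t i) (∑ i ∈ Finset.Icc 1 l, C.t i) ≤ p) :
    (colW n A 1 n : ℝ) >
      (min (∑ i ∈ Finset.Icc 1 k, B.t i) (∑ i ∈ Finset.Icc 1 l, C.t i) : ℕ) * L := by
  refine main_aux n A hA hw p hp L hL k l hk hl _ ?_ B C hTp
  have hw0 : (0 : ℝ) < (colW n A 1 n : ℝ) := by exact_mod_cast hw
  have : (p : ℝ) ≤ (p : ℝ) ^ 2 / (colW n A 1 n : ℝ) * L := by
    rw [div_mul_eq_mul_div, le_div_iff₀ hw0]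
    have hp1 : (1 : ℝ) ≤ p := by exact_mod_cast hp
    nlinarith
  linarith
end
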